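/- arXiv:2409.12665 — 4 statements merged into one kernel-verified Lean document; each statement's English description precedes it below -/
import Mathlib

section
/- Let g : ℝ → ℝ be defined by g(x) = x / sinh(x) for x ≠ 0 and g(0) = 1. Then g is integrable on ℝ and for every real ξ one has ∫_ℝ g(x) e^{-i ξ x} dx = π² / (1 + cosh(π ξ)). -/
open Real MeasureTheory

/-- The function `x ↦ x / sinh x`, extended continuously by `1` at `x = 0`. -/
noncomputable def xOverSinh (x : ℝ) : ℝ := if x = 0 then 1 else x / Real.sinh x

open Set Filter Topology

lemma norm_ofReal_mul_cexp_neg_mul (a : ℂ) {x : ℝ} (hx : 0 < x) :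
    ‖(x : ℂ) * Complex.exp (-a * x)‖ = x * Real.exp (-a.re * x) := by
  rw [norm_mul, Complex.norm_real, Complex.norm_exp, Real.norm_of_nonneg hx.le]
  simp

lemma integrableOn_mul_exp_neg_mul {b : ℝ} (hb : 0 < b) :
    IntegrableOn (fun x : ℝ ↦ x * Real.exp (-b * x)) (Ioi 0) := by
  simpa using integrableOn_rpow_mul_exp_neg_mul_rpow (s := 1) (p := 1) (by norm_num) one_pos hb

lemma integrableOn_ofReal_mul_cexp_neg_mul {a : ℂ} (ha : 0 < a.re) :
    IntegrableOn (fun x : ℝ ↦ (x : ℂ) * Complex.exp (-a * x)) (Ioi 0) := by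
  refine (integrableOn_mul_exp_neg_mul ha).mono' (by fun_prop) ?_
  filter_upwards [ae_restrict_mem measurableSet_Ioi] with x hx
  exact (norm_ofReal_mul_cexp_neg_mul a hx).le

lemma integral_ofReal_mul_cexp_neg_mul_Ioi {a : ℂ} (ha : 0 < a.re) :
    ∫ x : ℝ in Ioi 0, (x : ℂ) * Complex.exp (-a * x) = 1 / a ^ 2 := by
  have ha0 : a ≠ 0 := by rintro rfl; simp at ha
  have h_deriv (x : ℝ) : HasDerivAt
      (fun y : ℝ ↦ -(1 / a) * ((y : ℂ) * Complex.exp (-a * y))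
        - 1 / a ^ 2 * Complex.exp (-a * y))
      ((x : ℂ) * Complex.exp (-a * x)) x := by
    have h1 : HasDerivAt (fun y : ℝ ↦ (y : ℂ)) 1 x := Complex.ofRealCLM.hasDerivAt
    have h2 := (h1.const_mul (-a)).cexp
    convert! ((h1.mul h2).const_mul (-(1 / a))).sub (h2.const_mul (1 / a ^ 2)) using 1
    field_simp
    ring
  have h_exp : Tendsto (fun y : ℝ ↦ Complex.exp (-a * y)) atTop (𝓝 0) := by
    rw [Complex.tendsto_exp_nhds_zero_iff]
    simpa using tendsto_id.const_mul_atTop ha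
  have h_mul : Tendsto (fun y : ℝ ↦ (y : ℂ) * Complex.exp (-a * y)) atTop (𝓝 0) := by
    rw [tendsto_zero_iff_norm_tendsto_zero]
    refine (tendsto_rpow_mul_exp_neg_mul_atTop_nhds_zero 1 a.re ha).congr' ?_
    filter_upwards [eventually_gt_atTop 0] with x hx
    rw [norm_ofReal_mul_cexp_neg_mul a hx, Real.rpow_one]
  have h_lim := (h_mul.const_mul (-(1 / a))).sub (h_exp.const_mul (1 / a ^ 2))
  rw [integral_Ioi_of_hasDerivAt_of_tendsto' (fun x _ ↦ h_deriv x)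
    (integrableOn_ofReal_mul_cexp_neg_mul ha) h_lim]
  simp

lemma summable_one_div_two_mul_add_one_sq :
    Summable fun n : ℕ ↦ 1 / (2 * (n : ℝ) + 1) ^ 2 := by
  have h := (summable_nat_add_iff 1).mpr (Real.summable_one_div_nat_pow.mpr one_lt_two)
  refine h.of_nonneg_of_le (fun n ↦ by positivity) fun n ↦ ?_
  push_cast
  gcongr
  linarith [(Nat.cast_nonneg n : (0 : ℝ) ≤ n)]

lemma xOverSinh_neg (x : ℝ) : xOverSinh (-x) = xOverSinh x := by
  simp [xOverSinh, Real.sinh_neg]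

lemma measurable_xOverSinh : Measurable xOverSinh := by
  unfold xOverSinh
  exact Measurable.ite (measurableSet_singleton 0) measurable_const
    (measurable_id.div Real.measurable_sinh)

lemma norm_xOverSinh_le {x : ℝ} (hx : 0 < x) :
    ‖xOverSinh x‖ ≤ Real.exp (-1 * x) + 2 * (x * Real.exp (-1 * x)) := by
  have hs : 0 < Real.sinh x := Real.sinh_pos_iff.mpr hx
  rw [xOverSinh, if_neg hx.ne', Real.norm_of_nonneg (by positivity), div_le_iff₀ hs,
    Real.sinh_eq, neg_one_mul]
  have h1 : Real.exp (-x) * Real.exp x = 1 := by rw [← Real.exp_add]; simp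
  have h2 : (1 + 2 * x) * Real.exp (-x) ^ 2 ≤ 1 := by
    have := Real.add_one_le_exp (2 * x)
    calc (1 + 2 * x) * Real.exp (-x) ^ 2 ≤ Real.exp (2 * x) * Real.exp (-x) ^ 2 := by
          gcongr; linarith
      _ = 1 := by rw [two_mul, Real.exp_add]; linear_combination
                    (1 + Real.exp (-x) * Real.exp x) * h1
  linear_combination (1 / 2 : ℝ) * h2 - (1 / 2 + x) * h1

lemma integrable_xOverSinh : Integrable xOverSinh := by
  have h_pos : IntegrableOn xOverSinh (Ioi 0) := by
    refine ((integrableOn_exp_mul_Ioi (a := -1) (by norm_num) 0).add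
      ((integrableOn_mul_exp_neg_mul one_pos).const_mul 2)).mono'
      measurable_xOverSinh.aestronglyMeasurable ?_
    filter_upwards [ae_restrict_mem measurableSet_Ioi] with x hx
    exact norm_xOverSinh_le hx
  have h_neg : IntegrableOn (fun x ↦ xOverSinh (-x)) (Iic 0) :=
    IntegrableOn.comp_neg_Iic (by simpa [integrableOn_Ici_iff_integrableOn_Ioi] using h_pos)
  simp only [xOverSinh_neg] at h_neg
  rw [← integrableOn_univ, ← Iic_union_Ioi (a := (0 : ℝ))]
  exact h_neg.union h_pos

lemma norm_cexp_neg_I_mul_mul (ξ x : ℝ) : ‖Complex.exp (-Complex.I * ξ * x)‖ = 1 := by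
  simp [Complex.norm_exp]

lemma integrable_xOverSinh_mul_cexp (ξ : ℝ) :
    Integrable fun x : ℝ ↦ (xOverSinh x : ℂ) * Complex.exp (-Complex.I * ξ * x) := by
  refine integrable_xOverSinh.ofReal.mul_bdd (c := 1) (by fun_prop) ?_
  exact .of_forall fun x ↦ (norm_cexp_neg_I_mul_mul ξ x).le

lemma continuous_integral_xOverSinh_mul_cexp :
    Continuous fun ξ : ℝ ↦
      ∫ x : ℝ, (xOverSinh x : ℂ) * Complex.exp (-Complex.I * ξ * x) := by
  refine continuous_of_dominated
    (fun ξ ↦ (integrable_xOverSinh_mul_cexp ξ).aestronglyMeasurable)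
    (fun ξ ↦ .of_forall fun x ↦ ?_) integrable_xOverSinh.norm (.of_forall fun x ↦ by fun_prop)
  rw [norm_mul, norm_cexp_neg_I_mul_mul, mul_one, Complex.norm_real]

lemma hasSum_xOverSinh {x : ℝ} (hx : 0 < x) :
    HasSum (fun n : ℕ ↦ 2 * (x * Real.exp (-(2 * (n : ℝ) + 1) * x))) (xOverSinh x) := by
  have hs : 0 < Real.sinh x := Real.sinh_pos_iff.mpr hx
  have h1 : Real.exp (-x) * Real.exp x = 1 := by rw [← Real.exp_add]; simp
  have hlt : Real.exp (-x) ^ 2 < 1 :=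
    pow_lt_one₀ (Real.exp_pos _).le (Real.exp_lt_one_iff.mpr (by linarith)) two_ne_zero
  have h := (hasSum_geometric_of_lt_one (by positivity) hlt).mul_left (2 * (x * Real.exp (-x)))
  convert! h using 1
  · ext n
    rw [← pow_mul, ← Real.exp_nat_mul, mul_assoc 2, mul_assoc x, ← Real.exp_add]
    push_cast
    ring_nf
  · have h3 : 1 - Real.exp (-x) ^ 2 ≠ 0 := by linarith
    rw [xOverSinh, if_neg hx.ne', ← div_eq_mul_inv, div_eq_div_iff hs.ne' h3, Real.sinh_eq]
    linear_combination -x * h1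

/-- The half-line Fourier integral of `x / sinh x` as a series. -/
lemma hasSum_integral_Ioi_xOverSinh_mul_cexp (ξ : ℝ) :
    HasSum (fun n : ℕ ↦ 2 * (1 / (2 * (n : ℂ) + 1 + Complex.I * ξ) ^ 2))
      (∫ x : ℝ in Ioi 0, (xOverSinh x : ℂ) * Complex.exp (-Complex.I * ξ * x)) := by
  set a : ℕ → ℂ := fun n ↦ 2 * (n : ℂ) + 1 + Complex.I * ξ
  have ha (n : ℕ) : (a n).re = 2 * (n : ℝ) + 1 := by simp [a]
  have ha_pos (n : ℕ) : 0 < (a n).re := by rw [ha]; positivity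
  have h_norm (n : ℕ) : ∫ x : ℝ in Ioi 0, ‖2 * ((x : ℂ) * Complex.exp (-a n * x))‖
      = 2 * (1 / (2 * (n : ℝ) + 1) ^ 2) := by
    have h := Real.integral_rpow_mul_exp_neg_mul_Ioi (a := 2) two_pos (ha_pos n)
    rw [Real.Gamma_two, mul_one, ha, Real.rpow_two, one_div_pow] at h
    rw [← h, ← integral_const_mul]
    refine setIntegral_congr_fun measurableSet_Ioi fun x hx ↦ ?_
    rw [norm_mul, norm_ofReal_mul_cexp_neg_mul _ hx, ha, neg_mul]
    norm_num
  have h := hasSum_integral_of_summable_integral_norm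
    (F := fun (n : ℕ) (x : ℝ) ↦ 2 * ((x : ℂ) * Complex.exp (-a n * x)))
    (μ := volume.restrict (Ioi 0))
    (fun n ↦ (integrableOn_ofReal_mul_cexp_neg_mul (ha_pos n)).const_mul 2)
    (by simpa only [h_norm] using summable_one_div_two_mul_add_one_sq.mul_left 2)
  simp only [integral_const_mul, integral_ofReal_mul_cexp_neg_mul_Ioi (ha_pos _)] at h
  convert! h using 1
  refine setIntegral_congr_fun measurableSet_Ioi fun x hx ↦ ?_
  have hx_sum := (Complex.hasSum_ofReal.mpr (hasSum_xOverSinh hx)).mul_right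
    (Complex.exp (-Complex.I * ξ * x))
  rw [← hx_sum.tsum_eq]
  refine tsum_congr fun n ↦ ?_
  push_cast
  rw [mul_assoc, mul_assoc, ← Complex.exp_add]
  congr 3
  simp only [a]
  ring

lemma integral_xOverSinh_mul_cexp_eq_add (ξ : ℝ) :
    ∫ x : ℝ, (xOverSinh x : ℂ) * Complex.exp (-Complex.I * ξ * x)
      = (∫ x : ℝ in Ioi 0, (xOverSinh x : ℂ) * Complex.exp (-Complex.I * ξ * x))
        + ∫ x : ℝ in Ioi 0,
          (xOverSinh x : ℂ) * Complex.exp (-Complex.I * (-ξ : ℝ) * x) := by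
  have h_int := integrable_xOverSinh_mul_cexp ξ
  rw [← intervalIntegral.integral_Iic_add_Ioi (b := 0) h_int.integrableOn h_int.integrableOn,
    add_comm]
  congr 1
  have h := integral_comp_neg_Ioi 0
    (fun x : ℝ ↦ (xOverSinh x : ℂ) * Complex.exp (-Complex.I * ξ * x))
  rw [neg_zero] at h
  rw [← h]
  simp [xOverSinh_neg]

/-- The Lipschitz formula of weight two on the line `re z = 1 / 2`. -/
lemma tsum_one_div_half_add_sq {ξ : ℝ} (hξ : 0 < ξ) :
    ∑' n : ℤ, 1 / ((1 + Complex.I * ξ) / 2 + n) ^ 2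
      = ((2 * (π ^ 2 / (1 + Real.cosh (π * ξ))) : ℝ) : ℂ) := by
  have him : 0 < ((1 + Complex.I * ξ) / 2 : ℂ).im := by simpa using hξ
  have h := EisensteinSeries.qExpansion_identity (k := 1) le_rfl ⟨_, him⟩
  have hq : Complex.exp (2 * π * Complex.I * ((1 + Complex.I * ξ) / 2))
      = -(Real.exp (-(π * ξ)) : ℂ) := by
    rw [show 2 * π * Complex.I * ((1 + Complex.I * ξ) / 2)
      = π * Complex.I + ((-(π * ξ) : ℝ) : ℂ) by
        push_cast; linear_combination (π * ξ : ℂ) * Complex.I_sq,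
      Complex.exp_add, Complex.exp_pi_mul_I, ← Complex.ofReal_exp, neg_one_mul]
  have hlt : Real.exp (-(π * ξ)) < 1 := Real.exp_lt_one_iff.mpr (by simpa using by positivity)
  simp only [hq, pow_one] at h
  rw [tsum_coe_mul_geometric_of_norm_lt_one
    (by rwa [norm_neg, Complex.norm_real, Real.norm_of_nonneg (Real.exp_pos _).le])] at h
  have h1 : Real.exp (-(π * ξ)) * Real.exp (π * ξ) = 1 := by rw [← Real.exp_add]; simp
  have hreal : 4 * π ^ 2 * (Real.exp (-(π * ξ)) / (1 + Real.exp (-(π * ξ))) ^ 2)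
      = 2 * (π ^ 2 / (1 + Real.cosh (π * ξ))) := by
    have hp := Real.exp_pos (-(π * ξ))
    have hp' := Real.exp_pos (π * ξ)
    rw [Real.cosh_eq]
    field_simp
    linear_combination 4 * h1
  rw [← hreal]
  refine h.trans ?_
  push_cast
  rw [sub_neg_eq_add, mul_pow, Complex.I_sq]
  simp
  ring

lemma integral_xOverSinh_mul_cexp_of_pos {ξ : ℝ} (hξ : 0 < ξ) :
    ∫ x : ℝ, (xOverSinh x : ℂ) * Complex.exp (-Complex.I * ξ * x)
      = ((π ^ 2 / (1 + Real.cosh (π * ξ)) : ℝ) : ℂ) := by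
  have h_nat := (hasSum_integral_Ioi_xOverSinh_mul_cexp ξ).mul_left 2
  have h_neg := (hasSum_integral_Ioi_xOverSinh_mul_cexp (-ξ)).mul_left 2
  have h_int := HasSum.of_nat_of_neg_add_one
    (f := fun n : ℤ ↦ 1 / ((1 + Complex.I * ξ) / 2 + n) ^ 2)
    (h_nat.congr_fun fun n ↦ ?_) (h_neg.congr_fun fun n ↦ ?_)
  · rw [← mul_add, ← integral_xOverSinh_mul_cexp_eq_add] at h_int
    have h := h_int.tsum_eq.symm.trans (tsum_one_div_half_add_sq hξ)
    rw [Complex.ofReal_mul, Complex.ofReal_ofNat] at h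
    exact mul_left_cancel₀ two_ne_zero h
  · rw [show (1 + Complex.I * ξ) / 2 + ((n : ℤ) : ℂ)
      = (2 * (n : ℂ) + 1 + Complex.I * ξ) / 2 by push_cast; ring, div_pow, one_div_div]
    ring
  · rw [show (1 + Complex.I * ξ) / 2 + ((-((n : ℤ) + 1) : ℤ) : ℂ)
      = -((2 * (n : ℂ) + 1 + Complex.I * (-ξ : ℝ)) / 2) by push_cast; ring, neg_sq, div_pow,
      one_div_div]
    ring

/-- `x ↦ x / sinh x` (extended by `1` at `0`) is integrable on `ℝ` and its Fourier
transform is `ξ ↦ π² / (1 + cosh (π ξ))`. -/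
theorem fourierTransform_xOverSinh :
    Integrable xOverSinh ∧
    ∀ ξ : ℝ, ∫ x : ℝ, (xOverSinh x : ℂ) * Complex.exp (-Complex.I * (ξ : ℂ) * (x : ℂ))
      = ((π ^ 2 / (1 + Real.cosh (π * ξ)) : ℝ) : ℂ) := by
  refine ⟨integrable_xOverSinh, fun ξ ↦ ?_⟩
  have h_cont : Continuous fun ξ : ℝ ↦ ((π ^ 2 / (1 + Real.cosh (π * ξ)) : ℝ) : ℂ) :=
    Complex.continuous_ofReal.comp <| continuous_const.div (by fun_prop) fun ξ ↦
      (add_pos one_pos (Real.cosh_pos _)).ne'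
  refine congr_fun (Continuous.ext_on (dense_compl_singleton (0 : ℝ))
    continuous_integral_xOverSinh_mul_cexp h_cont fun ξ hξ ↦ ?_) ξ
  rcases lt_or_gt_of_ne (show ξ ≠ 0 from hξ) with h | h
  · have h_pos := integral_xOverSinh_mul_cexp_of_pos (neg_pos.mpr h)
    rw [integral_xOverSinh_mul_cexp_eq_add, neg_neg, add_comm,
      ← integral_xOverSinh_mul_cexp_eq_add, mul_neg, Real.cosh_neg] at h_pos
    exact h_pos
  · exact integral_xOverSinh_mul_cexp_of_pos h
end

section
/- For every real z > 0, the series Σ_{m=1}^∞ m / sinh(m z) and Σ_{l=1}^∞ 1 / (1 + cosh(2π² l / z)) both converge, and Σ_{m=1}^∞ m / sinh(m z) = π²/(4 z²) − 1/(2z) + (π²/z²) Σ_{l=1}^∞ 1 / (1 + cosh(2π² l / z)). (This is the Poisson-summation identity for the Heisenberg heat-type trace, obtained from the Fourier transform of x/sinh x.) -/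
open Real

open scoped ArithmeticFunction.sigma in
/-- The generating series `∑ σ₁(n) rⁿ`. -/
noncomputable def sigmaSeries (r : ℝ) : ℝ := ∑' n : ℕ+, (σ 1 n : ℝ) * r ^ (n : ℕ)

theorem hasSum_succ_iff_hasSum_pnat {f : ℕ → ℝ} {a : ℝ} :
    HasSum (fun n : ℕ => f (n + 1)) a ↔ HasSum (fun n : ℕ+ => f n) a := by
  rw [← Equiv.pnatEquivNat.symm.hasSum_iff]
  rfl

theorem hasSum_mul_pow_div_one_sub_pow {r : ℝ} (h0 : 0 < r) (h1 : r < 1) :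
    HasSum (fun n : ℕ => ((n : ℝ) + 1) * r ^ (n + 1) / (1 - r ^ (n + 1))) (sigmaSeries r) := by
  have hr : ‖r‖ < 1 := by rwa [Real.norm_of_nonneg h0.le]
  have hs : Summable fun n : ℕ+ => ((n : ℕ) : ℝ) ^ 1 * r ^ (n : ℕ) / (1 - r ^ (n : ℕ)) :=
    (summable_norm_pow_mul_geometric_div_one_sub 1 hr).comp_injective PNat.coe_injective
  have h := hs.hasSum
  rw [tsum_pow_div_one_sub_eq_tsum_sigma hr 1] at h
  have h' := (hasSum_succ_iff_hasSum_pnat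
    (f := fun n : ℕ => (n : ℝ) ^ 1 * r ^ n / (1 - r ^ n))).2 h
  simpa only [sigmaSeries, pow_one, Nat.cast_add, Nat.cast_one] using h'

theorem hasSum_pow_div_one_sub_pow_sq {r : ℝ} (h0 : 0 < r) (h1 : r < 1) :
    HasSum (fun n : ℕ => r ^ (n + 1) / (1 - r ^ (n + 1)) ^ 2) (sigmaSeries r) := by
  have hr : ‖r‖ < 1 := by rwa [Real.norm_of_nonneg h0.le]
  have hs := summable_prod_mul_pow 1 hr
  have hs' := hs.prod.hasSum
  rw [tsum_prod_pow_eq_tsum_sigma 1 hr] at hs'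
  refine hasSum_succ_iff_hasSum_pnat (f := fun n : ℕ => r ^ n / (1 - r ^ n) ^ 2).2 ?_
  convert! hs' using 2 with d
  have hd : ‖r ^ (d : ℕ)‖ < 1 := by
    rw [norm_pow]
    exact pow_lt_one₀ (norm_nonneg _) hr d.ne_zero
  rw [← tsum_coe_mul_geometric_of_norm_lt_one hd, ← tsum_zero_pnat_eq_tsum_nat]
  · simp [pow_mul]
  · simpa using summable_norm_pow_mul_geometric_of_norm_lt_one 1 hd |>.of_norm

theorem hasSum_pow_div_one_add_pow_sq {r : ℝ} (h0 : 0 < r) (h1 : r < 1) :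
    HasSum (fun n : ℕ => r ^ (n + 1) / (1 + r ^ (n + 1)) ^ 2)
      (sigmaSeries r - 4 * sigmaSeries (r ^ 2)) := by
  convert! (hasSum_pow_div_one_sub_pow_sq h0 h1).sub
    ((hasSum_pow_div_one_sub_pow_sq (pow_pos h0 2) (pow_lt_one₀ h0.le h1 two_ne_zero)).mul_left 4)
    using 2 with n
  rw [pow_right_comm]
  have hx0 : 0 < r ^ (n + 1) := pow_pos h0 _
  have hx1 : r ^ (n + 1) < 1 := pow_lt_one₀ h0.le h1 n.succ_ne_zero
  generalize r ^ (n + 1) = x at hx0 hx1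
  have e : 1 - x ^ 2 = (1 - x) * (1 + x) := by ring
  rw [e]
  have h2 : 1 - x ≠ 0 := by linarith
  have h3 : 1 + x ≠ 0 := by linarith
  field_simp
  ring

theorem hasSum_mul_pow_div_one_sub_pow_two_mul {r : ℝ} (h0 : 0 < r) (h1 : r < 1) :
    HasSum (fun n : ℕ => ((n : ℝ) + 1) * r ^ (n + 1) / (1 - (r ^ (n + 1)) ^ 2))
      (sigmaSeries r - sigmaSeries (r ^ 2)) := by
  convert! (hasSum_mul_pow_div_one_sub_pow h0 h1).sub
    (hasSum_mul_pow_div_one_sub_pow (pow_pos h0 2) (pow_lt_one₀ h0.le h1 two_ne_zero))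
    using 2 with n
  rw [pow_right_comm r 2 (n + 1)]
  have hx0 : 0 < r ^ (n + 1) := pow_pos h0 _
  have hx1 : r ^ (n + 1) < 1 := pow_lt_one₀ h0.le h1 n.succ_ne_zero
  generalize r ^ (n + 1) = x at hx0 hx1
  have e : 1 - x ^ 2 = (1 - x) * (1 + x) := by ring
  rw [e]
  have h2 : 1 - x ≠ 0 := by linarith
  have h3 : 1 + x ≠ 0 := by linarith
  field_simp
  ring

open EisensteinSeries UpperHalfPlane in
theorem G2_eq_sigmaSeries {t : ℝ} (τ : ℍ) (hτ : (τ : ℂ) = (t / (2 * π) : ℝ) * Complex.I) :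
    G2 τ = ((π ^ 2 / 3 - 8 * π ^ 2 * sigmaSeries (exp (-t)) : ℝ) : ℂ) := by
  have hq : Complex.exp (2 * π * Complex.I * τ) = (exp (-t) : ℝ) := by
    rw [hτ, Complex.ofReal_exp]
    congr 1
    push_cast
    have : (π : ℂ) ≠ 0 := by exact_mod_cast pi_ne_zero
    field_simp
    simp
  rw [G2_eq_tsum_cexp, riemannZeta_two, hq, sigmaSeries]
  push_cast
  ring

open EisensteinSeries UpperHalfPlane in
theorem sigmaSeries_exp_neg_transform {t : ℝ} (ht : 0 < t) :
    1 / 24 - sigmaSeries (exp (-t)) =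
      -(4 * π ^ 2 / t ^ 2) * (1 / 24 - sigmaSeries (exp (-(4 * π ^ 2 / t)))) + 1 / (2 * t) := by
  let τ : ℍ := ⟨(t / (2 * π) : ℝ) * Complex.I, by
    rw [Complex.im_ofReal_mul, Complex.I_im, mul_one]; positivity⟩
  have hτ : (τ : ℂ) = (t / (2 * π) : ℝ) * Complex.I := rfl
  have hpi : (π : ℂ) ≠ 0 := by exact_mod_cast pi_ne_zero
  have htc : (t : ℂ) ≠ 0 := by exact_mod_cast ht.ne'
  have hS : ((ModularGroup.S • τ : ℍ) : ℂ) = ((4 * π ^ 2 / t) / (2 * π) : ℝ) * Complex.I := by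
    rw [modular_S_smul, UpperHalfPlane.coe_mk, hτ]
    push_cast
    rw [inv_eq_iff_eq_inv]
    field_simp
    simp
    ring
  have h := G2_S_transform τ
  rw [G2_eq_sigmaSeries τ hτ, G2_eq_sigmaSeries _ hS, hτ] at h
  have h' : ((π ^ 2 / 3 - 8 * π ^ 2 * sigmaSeries (exp (-t)) : ℝ) : ℂ) =
      ((-(4 * π ^ 2 / t ^ 2) * (π ^ 2 / 3 - 8 * π ^ 2 * sigmaSeries (exp (-(4 * π ^ 2 / t))))
        + 4 * π ^ 2 / t : ℝ) : ℂ) := by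
    rw [h]
    push_cast
    rw [mul_pow, Complex.I_sq]
    field_simp
    ring
  have h'' := Complex.ofReal_injective h'
  have hp := pi_pos
  field_simp at h'' ⊢
  linarith



/-- Poisson-summation identity for the Heisenberg heat-type trace: for `z > 0`,
`Σ_{m≥1} m / sinh(m z) = π²/(4z²) − 1/(2z) + (π²/z²) Σ_{l≥1} 1/(1 + cosh(2π² l / z))`,
both series being convergent. -/
theorem heisenberg_poisson_summation (z : ℝ) (hz : 0 < z) :
    Summable (fun m : ℕ => ((m : ℝ) + 1) / Real.sinh (((m : ℝ) + 1) * z)) ∧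
    Summable (fun l : ℕ => 1 / (1 + Real.cosh (2 * π ^ 2 * ((l : ℝ) + 1) / z))) ∧
    ∑' m : ℕ, ((m : ℝ) + 1) / Real.sinh (((m : ℝ) + 1) * z)
      = π ^ 2 / (4 * z ^ 2) - 1 / (2 * z)
        + (π ^ 2 / z ^ 2) * ∑' l : ℕ, 1 / (1 + Real.cosh (2 * π ^ 2 * ((l : ℝ) + 1) / z)) := by
  have hsinh : HasSum (fun m : ℕ => ((m : ℝ) + 1) / Real.sinh (((m : ℝ) + 1) * z))
      (2 * (sigmaSeries (exp (-z)) - sigmaSeries (exp (-z) ^ 2))) := by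
    convert! (hasSum_mul_pow_div_one_sub_pow_two_mul (exp_pos (-z))
      (exp_lt_one_iff.2 (neg_lt_zero.2 hz))).mul_left 2 using 2 with m
    have hx : rexp (-z) ^ (m + 1) = rexp (-((m + 1) * z)) := by
      rw [← exp_nat_mul]; push_cast; ring_nf
    have hm : 0 < ((m : ℝ) + 1) * z := by positivity
    rw [hx, sinh_eq, exp_neg]
    have h1 := one_lt_exp_iff.2 hm
    generalize rexp ((m + 1) * z) = y at h1
    have h2 : y ^ 2 - 1 ≠ 0 := by nlinarith
    field_simp
  set Y := 2 * π ^ 2 / z with hYdef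
  have hY : 0 < Y := by positivity
  have hcosh : HasSum (fun l : ℕ => 1 / (1 + Real.cosh (2 * π ^ 2 * ((l : ℝ) + 1) / z)))
      (2 * (sigmaSeries (exp (-Y)) - 4 * sigmaSeries (exp (-Y) ^ 2))) := by
    convert! (hasSum_pow_div_one_add_pow_sq (exp_pos (-Y))
      (exp_lt_one_iff.2 (neg_lt_zero.2 hY))).mul_left 2 using 2 with l
    have hx : rexp (-Y) ^ (l + 1) = rexp (-(2 * π ^ 2 * ((l : ℝ) + 1) / z)) := by
      rw [← exp_nat_mul, hYdef]; push_cast; ring_nf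
    rw [hx, cosh_eq, exp_neg]
    have h1 := exp_pos (2 * π ^ 2 * ((l : ℝ) + 1) / z)
    generalize rexp (2 * π ^ 2 * ((l : ℝ) + 1) / z) = y at h1
    have h2 : 2 * y + y ^ 2 + 1 ≠ 0 := by positivity
    field_simp
    ring
  refine ⟨hsinh.summable, hcosh.summable, ?_⟩
  rw [hsinh.tsum_eq, hcosh.tsum_eq, ← exp_nat_mul, ← exp_nat_mul]
  have hA := sigmaSeries_exp_neg_transform hz
  have hB := sigmaSeries_exp_neg_transform (t := 2 * z) (by positivity)
  rw [show 4 * π ^ 2 / z = 2 * Y by rw [hYdef]; ring] at hA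
  rw [show 4 * π ^ 2 / (2 * z) = Y by rw [hYdef]; field_simp; ring] at hB
  rw [show ((2 : ℕ) : ℝ) * -z = -(2 * z) by push_cast; ring,
    show ((2 : ℕ) : ℝ) * -Y = -(2 * Y) by push_cast; ring]
  linear_combination 2 * hB - 2 * hA
end

section
/- As z → 0⁺, z² · Σ_{m=1}^∞ m / sinh(m z) tends to π²/4. (This recovers the leading Weyl-law behavior Z_o(z) ∼ π²/(4z²) of the Heisenberg heat-type trace.) -/
open Real Filter Topology

/-- The sum of the reciprocals of the odd squares. -/
lemma hasSum_one_div_odd_sq : HasSum (fun l : ℕ => 1 / (2 * (l : ℝ) + 1) ^ 2) (π ^ 2 / 8) := by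
  let f : ℕ → ℝ := fun n => 1 / (n : ℝ) ^ 2
  have hs : HasSum f (π ^ 2 / 6) := hasSum_zeta_two
  have he : HasSum (fun k => f (2 * k)) (1 / 4 * (π ^ 2 / 6)) := by
    convert! hs.mul_left (1 / 4 : ℝ) using 2 with k
    simp only [f]
    push_cast
    rw [mul_pow, one_div_mul_one_div]
    norm_num
  have hinj : Function.Injective fun k : ℕ => 2 * k + 1 := fun a b h => by
    simpa using h
  have ho : Summable (fun k => f (2 * k + 1)) := hs.summable.comp_injective hinj
  have h := (he.even_add_odd ho.hasSum).unique hs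
  convert! ho.hasSum using 1
  · funext l
    simp [f]
  · linarith

/-- The expansion of `1 / sinh x` in odd powers of `exp (-x)`. -/
lemma hasSum_one_div_sinh {x : ℝ} (hx : 0 < x) :
    HasSum (fun l : ℕ => 2 * exp (-((2 * (l : ℝ) + 1) * x))) (1 / sinh x) := by
  have hr : exp (-(2 * x)) < 1 := exp_lt_one_iff.2 (by linarith)
  convert! (hasSum_geometric_of_lt_one (exp_nonneg _) hr).mul_left (2 * exp (-x)) using 1
  · funext l
    rw [← exp_nat_mul, mul_assoc, ← exp_add]
    ring_nf
  · have h : exp (-(2 * x)) = exp (-x) * exp (-x) := by rw [← exp_add]; ring_nf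
    have h1 : exp x * exp (-x) = 1 := by rw [← exp_add]; simp
    have h2 : sinh x ≠ 0 := (sinh_pos_iff.2 hx).ne'
    have h3 : 1 - exp (-(2 * x)) ≠ 0 := by linarith
    rw [← div_eq_mul_inv, div_eq_div_iff h2 h3, sinh_eq, h]
    linear_combination -h1

/-- The expansion of `1 / sinh x ^ 2` in even powers of `exp (-x)`. -/
lemma hasSum_one_div_sinh_sq {x : ℝ} (hx : 0 < x) :
    HasSum (fun m : ℕ => 2 * ((m : ℝ) + 1) * exp (-(((m : ℝ) + 1) * (2 * x))))
      (1 / (2 * sinh x ^ 2)) := by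
  have hr : exp (-(2 * x)) < 1 := exp_lt_one_iff.2 (by linarith)
  have h0 := hasSum_coe_mul_geometric_of_norm_lt_one
    (r := exp (-(2 * x))) (by rwa [norm_of_nonneg (exp_nonneg _)])
  convert! ((hasSum_nat_add_iff' 1).2 h0).mul_left 2 using 1
  · funext m
    rw [← exp_nat_mul]
    push_cast
    ring_nf
  · have h : exp (-(2 * x)) = exp (-x) * exp (-x) := by rw [← exp_add]; ring_nf
    have h1 : exp x * exp (-x) = 1 := by rw [← exp_add]; simp
    have h2 : sinh x ≠ 0 := (sinh_pos_iff.2 hx).ne'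
    have h3 : 1 - exp (-(2 * x)) = 2 * exp (-x) * sinh x := by
      rw [sinh_eq, h]; linear_combination -h1
    have h4 := (exp_pos (-x)).ne'
    rw [h3, h]
    simp only [Finset.range_one, Finset.sum_singleton, Nat.cast_zero, zero_mul, sub_zero]
    field_simp

lemma one_div_two_mul_sinh_sq_le {x : ℝ} (hx : 0 < x) :
    1 / (2 * sinh x ^ 2) ≤ 1 / (2 * x ^ 2) := by
  have := self_le_sinh_iff.2 hx.le
  gcongr

/-- Summing the heat-type trace over `m` before `l`. -/
lemma tsum_div_sinh_eq {z : ℝ} (hz : 0 < z) :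
    ∑' m : ℕ, ((m : ℝ) + 1) / sinh (((m : ℝ) + 1) * z) =
      ∑' l : ℕ, 1 / (2 * sinh ((2 * (l : ℝ) + 1) * z / 2) ^ 2) := by
  let f : ℕ → ℕ → ℝ := fun l m =>
    2 * ((m : ℝ) + 1) * exp (-(((m : ℝ) + 1) * ((2 * (l : ℝ) + 1) * z)))
  have hl (l : ℕ) : HasSum (f l) (1 / (2 * sinh ((2 * (l : ℝ) + 1) * z / 2) ^ 2)) := by
    have h := hasSum_one_div_sinh_sq (x := (2 * (l : ℝ) + 1) * z / 2) (by positivity)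
    rwa [mul_div_cancel₀ _ (two_ne_zero' ℝ)] at h
  have hm (m : ℕ) : HasSum (fun l => f l m) (((m : ℝ) + 1) / sinh (((m : ℝ) + 1) * z)) := by
    convert! (hasSum_one_div_sinh (x := ((m : ℝ) + 1) * z) (by positivity)).mul_left ((m : ℝ) + 1)
      using 1
    · funext l
      simp only [f]
      ring_nf
    · ring
  have hf : Summable (Function.uncurry f) := by
    refine (summable_prod_of_nonneg fun p => ?_).2 ⟨fun l => (hl l).summable, ?_⟩
    · simp only [Function.uncurry, f, Pi.zero_apply]
      positivity
    · simp only [Function.uncurry, (hl _).tsum_eq]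
      refine Summable.of_nonneg_of_le (fun l => by positivity)
        (fun l => one_div_two_mul_sinh_sq_le (by positivity))
        ((hasSum_one_div_odd_sq.summable.mul_left (2 / z ^ 2)).congr fun l => ?_)
      field_simp
  rw [← tsum_congr fun m => (hm m).tsum_eq, ← tsum_congr fun l => (hl l).tsum_eq]
  exact hf.tsum_comm

lemma tendsto_sq_div_sinh_sq {a : ℝ} (ha : 0 < a) :
    Tendsto (fun z : ℝ => z ^ 2 * (1 / (2 * sinh (a * z / 2) ^ 2))) (𝓝[>] 0)
      (𝓝 (2 * (1 / a ^ 2))) := by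
  have h : HasDerivAt (fun z : ℝ => sinh (a * z / 2)) (a / 2) 0 := by
    simpa using (((hasDerivAt_id (0 : ℝ)).const_mul a).div_const 2).sinh
  have h1 := (hasDerivAt_iff_tendsto_slope.1 h).mono_left
    (nhdsWithin_mono 0 fun x (hx : 0 < x) => hx.ne')
  have h2 := ((h1.pow 2).inv₀ (by positivity)).mul_const (1 / 2)
  convert! h2 using 2 with z
  · simp only [slope_def_field, mul_zero, zero_div, sinh_zero, sub_zero, one_div, div_pow, inv_div,
      mul_inv]
    ring
  · field_simp

/-- As `z → 0⁺`, `z² Σ_{m≥1} m / sinh(m z)` tends to `π²/4` (leading Weyl behaviour of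
the Heisenberg heat-type trace). -/
theorem heisenberg_trace_weyl_leading :
    Tendsto (fun z : ℝ => z ^ 2 * ∑' m : ℕ, ((m : ℝ) + 1) / Real.sinh (((m : ℝ) + 1) * z))
      (𝓝[>] 0) (𝓝 (π ^ 2 / 4)) := by
  have hs := hasSum_one_div_odd_sq.mul_left 2
  have key : Tendsto
      (fun z : ℝ => ∑' l : ℕ, z ^ 2 * (1 / (2 * sinh ((2 * (l : ℝ) + 1) * z / 2) ^ 2)))
      (𝓝[>] 0) (𝓝 (∑' l : ℕ, 2 * (1 / (2 * (l : ℝ) + 1) ^ 2))) := by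
    refine tendsto_tsum_of_dominated_convergence hs.summable
      (fun l => tendsto_sq_div_sinh_sq (by positivity)) ?_
    filter_upwards [self_mem_nhdsWithin] with z (hz : 0 < z) l
    rw [norm_of_nonneg (by positivity)]
    calc _ ≤ z ^ 2 * (1 / (2 * ((2 * (l : ℝ) + 1) * z / 2) ^ 2)) := by
          refine mul_le_mul_of_nonneg_left ?_ (sq_nonneg z)
          exact one_div_two_mul_sinh_sq_le (by positivity)
      _ = _ := by field_simp
  rw [hs.tsum_eq, show 2 * (π ^ 2 / 8) = π ^ 2 / 4 by ring] at key
  refine key.congr' ?_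
  filter_upwards [self_mem_nhdsWithin] with z (hz : 0 < z)
  rw [tsum_div_sinh_eq hz, tsum_mul_left]
end

section
/- Define, for z > 0, the remainder R(z) = Σ_{m=1}^∞ m / sinh(m z) − π²/(4z²) + 1/(2z). Then as z → 0⁺, z² e^{2π²/z} R(z) tends to 2π²; in other words the heat-type trace of the Heisenberg sub-Laplacian has, beyond its Weyl terms, exponentially small corrections whose leading term is (2π²/z²) e^{-2π²/z}, and the exponent 2π² equals L²/4 for the shortest closed geodesic length L = 2π√2. -/
open Real Filter Topology

/-- The remainder of the Heisenberg heat-type trace beyond its Weyl terms. -/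
noncomputable def heisenbergRemainder (z : ℝ) : ℝ :=
  (∑' m : ℕ, ((m : ℝ) + 1) / Real.sinh (((m : ℝ) + 1) * z)) - π ^ 2 / (4 * z ^ 2) + 1 / (2 * z)

/-- The Lambert series `∑ n qⁿ / (1 - qⁿ)` over `n ≥ 1`, divided by `q`. -/
noncomputable def lambertQuotient (q : ℝ) : ℝ :=
  ∑' n : ℕ, ((n : ℝ) + 1) * q ^ n / (1 - q ^ (n + 1))

theorem summable_lambertQuotient {q : ℝ} (hq0 : 0 < q) (hq1 : q < 1) :
    Summable fun n : ℕ => ((n : ℝ) + 1) * q ^ n / (1 - q ^ (n + 1)) := by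
  have h := summable_norm_pow_mul_geometric_div_one_sub 1
    (show ‖q‖ < 1 by rwa [Real.norm_eq_abs, abs_of_pos hq0])
  refine (((summable_nat_add_iff 1).mpr h).mul_left q⁻¹).congr fun n => ?_
  push_cast
  field_simp
  ring

theorem tendsto_lambertQuotient : Tendsto lambertQuotient (𝓝[>] 0) (𝓝 1) := by
  have h1 : ∑' n : ℕ, ((n : ℝ) + 1) * 0 ^ n / (1 - 0 ^ (n + 1)) = 1 := by
    rw [tsum_eq_single 0 fun n hn => by simp [hn]]
    simp
  rw [← h1]
  have hs : Summable fun n : ℕ => 2 * (((n : ℝ) + 1) * (1 / 2) ^ n) := by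
    have h := summable_pow_mul_geometric_of_norm_lt_one 1 (show ‖(1 / 2 : ℝ)‖ < 1 by norm_num)
    have h' := summable_geometric_of_norm_lt_one (show ‖(1 / 2 : ℝ)‖ < 1 by norm_num)
    exact ((h.add h').mul_left 2).congr fun n => by ring
  refine tendsto_tsum_of_dominated_convergence hs (fun n => ?_) ?_
  · have hc : ContinuousAt (fun q : ℝ => ((n : ℝ) + 1) * q ^ n / (1 - q ^ (n + 1))) 0 :=
      ContinuousAt.div (by fun_prop) (by fun_prop) (by simp)
    exact hc.tendsto.mono_left nhdsWithin_le_nhds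
  · filter_upwards [Ioo_mem_nhdsGT (show (0 : ℝ) < 1 / 2 by norm_num)] with q hq n
    have hq1 : q ^ (n + 1) ≤ 1 / 2 := by
      calc q ^ (n + 1) ≤ q := pow_le_of_le_one hq.1.le (by linarith [hq.2]) (by simp)
        _ ≤ 1 / 2 := hq.2.le
    have hq2 : q ^ n ≤ (1 / 2) ^ n := pow_le_pow_left₀ hq.1.le hq.2.le n
    have hq3 : 0 ≤ q ^ n := pow_nonneg hq.1.le n
    rw [Real.norm_of_nonneg (div_nonneg (by positivity) (by linarith)),
      div_le_iff₀ (by linarith)]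
    have hn : ((n : ℝ) + 1) * q ^ n ≤ ((n : ℝ) + 1) * (1 / 2) ^ n := by gcongr
    have : (0 : ℝ) ≤ ((n : ℝ) + 1) * (1 / 2) ^ n := by positivity
    nlinarith

theorem E2_mul_I_eq_lambertQuotient {t : ℝ} (τ : UpperHalfPlane) (hτ : (τ : ℂ) = t * Complex.I) :
    EisensteinSeries.E2 τ =
      ((1 - 24 * (rexp (-2 * π * t) * lambertQuotient (rexp (-2 * π * t))) : ℝ) : ℂ) := by
  have hq : Complex.exp (2 * π * Complex.I * τ) = (rexp (-2 * π * t) : ℝ) := by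
    rw [hτ, Complex.ofReal_exp]
    congr 1
    push_cast
    linear_combination 2 * π * t * Complex.I_mul_I
  rw [EisensteinSeries.E2_eq_tsum_cexp, lambertQuotient, ← tsum_mul_left (a := rexp (-2 * π * t)),
    ← tsum_pow_div_one_sub_eq_tsum_sigma (UpperHalfPlane.norm_exp_two_pi_I_lt_one τ),
    tsum_pnat_eq_tsum_succ (f := fun n : ℕ => (n : ℂ) ^ 1 *
      Complex.exp (2 * π * Complex.I * τ) ^ n / (1 - Complex.exp (2 * π * Complex.I * τ) ^ n)), hq]
  push_cast
  congr 2
  refine tsum_congr fun n => ?_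
  ring

theorem E2_S_transform (τ : UpperHalfPlane) :
    (τ : ℂ) ^ 2 * EisensteinSeries.E2 τ =
      EisensteinSeries.E2 (ModularGroup.S • τ) + 6 * Complex.I * τ / π := by
  have h := EisensteinSeries.G2_S_transform τ
  have hτ : (τ : ℂ) ≠ 0 := τ.ne_zero
  have hπ : (π : ℂ) ≠ 0 := by exact_mod_cast pi_ne_zero
  simp only [EisensteinSeries.E2, Pi.smul_apply, smul_eq_mul, riemannZeta_two]
  rw [h]
  field_simp
  ring

theorem lambertQuotient_inversion {t : ℝ} (ht : 0 < t) :
    1 - 24 * (rexp (-2 * π / t) * lambertQuotient (rexp (-2 * π / t))) =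
      -t ^ 2 * (1 - 24 * (rexp (-2 * π * t) * lambertQuotient (rexp (-2 * π * t)))) +
        6 * t / π := by
  let τ : UpperHalfPlane := ⟨t * Complex.I, by simpa using ht⟩
  have hτ : (τ : ℂ) = t * Complex.I := rfl
  have hS : ((ModularGroup.S • τ : UpperHalfPlane) : ℂ) = ((1 / t : ℝ) : ℂ) * Complex.I := by
    rw [UpperHalfPlane.modular_S_smul]
    simp [hτ, mul_comm]
  have h := E2_S_transform τ
  rw [E2_mul_I_eq_lambertQuotient τ hτ, E2_mul_I_eq_lambertQuotient _ hS, hτ, mul_pow,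
    Complex.I_sq] at h
  rw [mul_one_div] at h
  apply Complex.ofReal_injective
  push_cast at h ⊢
  linear_combination -h - 6 * t / π * Complex.I_mul_I

theorem tsum_div_sinh_eq_lambertQuotient {z : ℝ} (hz : 0 < z) :
    ∑' m : ℕ, ((m : ℝ) + 1) / Real.sinh (((m : ℝ) + 1) * z) =
      2 * (rexp (-z) * lambertQuotient (rexp (-z)) -
        rexp (-(2 * z)) * lambertQuotient (rexp (-(2 * z)))) := by
  have s1 := (summable_lambertQuotient (exp_pos (-z)) (by simpa using hz)).mul_left (rexp (-z))
  have s2 := (summable_lambertQuotient (exp_pos (-(2 * z))) (by simpa using hz)).mul_left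
    (rexp (-(2 * z)))
  simp only [lambertQuotient]
  rw [← tsum_mul_left, ← tsum_mul_left, ← s1.tsum_sub s2, ← tsum_mul_left]
  refine tsum_congr fun m => ?_
  have h2 : rexp (-(2 * z)) = rexp (-z) ^ 2 := by rw [← Real.exp_nat_mul]; push_cast; ring_nf
  have hx : rexp (-(((m : ℝ) + 1) * z)) = rexp (-z) ^ (m + 1) := by
    rw [← Real.exp_nat_mul]; push_cast; ring_nf
  have hx' : rexp (((m : ℝ) + 1) * z) = (rexp (-z) ^ (m + 1))⁻¹ := by
    rw [← hx, Real.exp_neg, inv_inv]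
  have h0 : 0 < rexp (-z) ^ (m + 1) := by positivity
  have h1 : rexp (-z) ^ (m + 1) < 1 := pow_lt_one₀ (exp_pos _).le (by simpa using hz) (by simp)
  have e1 : rexp (-z) * (((m : ℝ) + 1) * rexp (-z) ^ m / (1 - rexp (-z) ^ (m + 1))) =
      ((m : ℝ) + 1) * rexp (-z) ^ (m + 1) / (1 - rexp (-z) ^ (m + 1)) := by ring
  have e2 : rexp (-z) ^ 2 * (((m : ℝ) + 1) * (rexp (-z) ^ 2) ^ m /
      (1 - (rexp (-z) ^ 2) ^ (m + 1))) =
      ((m : ℝ) + 1) * (rexp (-z) ^ (m + 1)) ^ 2 / (1 - (rexp (-z) ^ (m + 1)) ^ 2) := by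
    rw [← pow_mul, ← pow_mul, ← pow_mul]; ring
  rw [Real.sinh_eq, h2, hx, hx', e1, e2]
  generalize rexp (-z) ^ (m + 1) = x at *
  have n1 : 1 - x ≠ 0 := by linarith
  have n2 : 1 + x ≠ 0 := by linarith
  have n3 : 1 - x ^ 2 = (1 - x) * (1 + x) := by ring
  have n4 : x⁻¹ - x = (1 - x) * (1 + x) / x := by field_simp; ring
  rw [n3, n4]
  field_simp
  ring

theorem heisenbergRemainder_eq {z : ℝ} (hz : 0 < z) :
    z ^ 2 * rexp (2 * π ^ 2 / z) * heisenbergRemainder z =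
      2 * π ^ 2 * (lambertQuotient (rexp (-(2 * π ^ 2 / z))) -
        4 * rexp (-(2 * π ^ 2 / z)) * lambertQuotient (rexp (-(2 * π ^ 2 / z)) ^ 2)) := by
  have hπ : π ≠ 0 := pi_ne_zero
  have h1 := lambertQuotient_inversion (t := z / (2 * π)) (by positivity)
  have h2 := lambertQuotient_inversion (t := z / π) (by positivity)
  rw [show -2 * π / (z / (2 * π)) = -(2 * π ^ 2 / z) + -(2 * π ^ 2 / z) by field_simp; ring,
    show -2 * π * (z / (2 * π)) = -z by field_simp, Real.exp_add, ← sq] at h1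
  rw [show -2 * π / (z / π) = -(2 * π ^ 2 / z) by field_simp,
    show -2 * π * (z / π) = -(2 * z) by field_simp] at h2
  have hp : rexp (2 * π ^ 2 / z) * rexp (-(2 * π ^ 2 / z)) = 1 := by
    rw [← Real.exp_add, add_neg_cancel, Real.exp_zero]
  rw [heisenbergRemainder, tsum_div_sinh_eq_lambertQuotient hz]
  generalize rexp (-z) * lambertQuotient (rexp (-z)) = A at *
  generalize rexp (-(2 * z)) * lambertQuotient (rexp (-(2 * z))) = B at *
  generalize rexp (-(2 * π ^ 2 / z)) = p at *
  generalize rexp (2 * π ^ 2 / z) = r at *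
  generalize lambertQuotient p = L at *
  generalize lambertQuotient (p ^ 2) = M at *
  have key : z ^ 2 * (2 * (A - B) - π ^ 2 / (4 * z ^ 2) + 1 / (2 * z)) =
      2 * π ^ 2 * (p * L - 4 * (p ^ 2 * M)) := by
    field_simp at h1 h2 ⊢
    linear_combination -(2 / 3) * h1 + (2 / 3) * h2
  linear_combination r * key + 2 * π ^ 2 * (L - 4 * p * M) * hp

/-- As `z → 0⁺`, `z² e^{2π²/z} R(z) → 2π²`: the remainder has leading exponentially small
term `(2π²/z²) e^{-2π²/z}`, and the exponent `2π²` equals `L²/4` for the shortest closed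
geodesic length `L = 2π√2`. -/
theorem heisenberg_trace_exponential_correction :
    Tendsto (fun z : ℝ => z ^ 2 * Real.exp (2 * π ^ 2 / z) * heisenbergRemainder z)
      (𝓝[>] 0) (𝓝 (2 * π ^ 2)) ∧
    2 * π ^ 2 = (2 * π * Real.sqrt 2) ^ 2 / 4 := by
  constructor
  · have h0 : Tendsto (fun z : ℝ => rexp (-(2 * π ^ 2 / z))) (𝓝[>] 0) (𝓝 0) := by
      refine Real.tendsto_exp_neg_atTop_nhds_zero.comp ?_
      exact tendsto_inv_nhdsGT_zero.const_mul_atTop (show 0 < 2 * π ^ 2 by positivity)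
    have hp : Tendsto (fun z : ℝ => rexp (-(2 * π ^ 2 / z))) (𝓝[>] 0) (𝓝[>] 0) :=
      tendsto_nhdsWithin_iff.mpr ⟨h0, .of_forall fun z => exp_pos _⟩
    have hp2 : Tendsto (fun z : ℝ => rexp (-(2 * π ^ 2 / z)) ^ 2) (𝓝[>] 0) (𝓝[>] 0) :=
      tendsto_nhdsWithin_iff.mpr
        ⟨by simpa using h0.pow 2, .of_forall fun z => pow_pos (exp_pos _) 2⟩
    have hlim := ((tendsto_lambertQuotient.comp hp).sub
      ((h0.const_mul 4).mul (tendsto_lambertQuotient.comp hp2))).const_mul (2 * π ^ 2)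
    simp only [mul_zero, sub_zero, mul_one] at hlim
    refine hlim.congr' ?_
    filter_upwards [self_mem_nhdsWithin] with z hz
    exact (heisenbergRemainder_eq hz).symm
  · rw [mul_pow, Real.sq_sqrt (by norm_num)]
    ring
end
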